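/- arXiv:1401.1388 — 11 statements merged into one kernel-verified Lean document; each statement's English description precedes it below -/
import Mathlib

section
/- Let Λ be a qubit channel with Kraus operators {Aᵢ}, let U, V be 2×2 unitary matrices, and set |Φ⟩ = (U⊗V)|Φ⁺⟩. Then for any vector ψ ∈ ℂ²⊗ℂ², ⟨Φ| (id⊗Λ)(|ψ⟩⟨ψ|) |Φ⟩ = ⟨ψ| ((UVᵀ)⊗1) ρ_{Φ⁺,Λ̂} ((UVᵀ)⊗1)† |ψ⟩, where Vᵀ is the transpose of V. -/
open Matrix
open scoped Kronecker

noncomputable section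

/-- 2×2 complex matrices (single-qubit operators). -/
abbrev QMat := Matrix (Fin 2) (Fin 2) ℂ

/-- 4×4 complex matrices indexed by `Fin 2 × Fin 2` (two-qubit operators). -/
abbrev TMat := Matrix (Fin 2 × Fin 2) (Fin 2 × Fin 2) ℂ

/-- Vectors in ℂ²⊗ℂ², indexed by `Fin 2 × Fin 2`. -/
abbrev TVec := (Fin 2 × Fin 2) → ℂ

/-- Outer product |ψ⟩⟨φ|. -/
def outer (ψ φ : TVec) : TMat := Matrix.vecMulVec ψ (star φ)

/-- The maximally entangled vector |Φ⁺⟩ = (|00⟩+|11⟩)/√2. -/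
def phiPlus : TVec := fun p => if p.1 = p.2 then ((Real.sqrt 2 : ℂ))⁻¹ else 0

/-- Action of id ⊗ Λ on two-qubit matrices, for a channel Λ with Kraus family `A`. -/
def channelOut {ι : Type*} [Fintype ι] (A : ι → QMat) (M : TMat) : TMat :=
  ∑ i, ((1 : QMat) ⊗ₖ A i) * M * ((1 : QMat) ⊗ₖ A i)ᴴ

/-- The Choi matrix ρ_{Φ⁺,Λ} = (id⊗Λ)(|Φ⁺⟩⟨Φ⁺|). -/
def choi {ι : Type*} [Fintype ι] (A : ι → QMat) : TMat :=
  channelOut A (outer phiPlus phiPlus)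

/-- The Choi matrix of the dual channel: ρ_{Φ⁺,Λ̂} = ∑ᵢ (1⊗Aᵢᴴ)|Φ⁺⟩⟨Φ⁺|(1⊗Aᵢ). -/
def choiDual {ι : Type*} [Fintype ι] (A : ι → QMat) : TMat :=
  channelOut (fun i => (A i)ᴴ) (outer phiPlus phiPlus)

/-- Kraus (trace-preserving) condition ∑ᵢ Aᵢᴴ Aᵢ = 1. -/
def IsKraus {ι : Type*} [Fintype ι] (A : ι → QMat) : Prop := ∑ i, (A i)ᴴ * A i = 1

/-- Partial trace over the second factor. -/
def ptraceB (M : TMat) : QMat := Matrix.of fun i j => ∑ k, M (i, k) (j, k)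

/-- Unit vector: ⟨ψ|ψ⟩ = 1. -/
def IsUnitVec (ψ : TVec) : Prop := star ψ ⬝ᵥ ψ = 1

/-- Maximally entangled vector: the partial trace of |ψ⟩⟨ψ| over the second
factor is (1/2)·1. -/
def MaxEnt (ψ : TVec) : Prop := ptraceB (outer ψ ψ) = (1/2 : ℂ) • 1

/-- Partial transpose on the first factor: M^Γ((i,k),(j,l)) = M((j,k),(i,l)). -/
def ptransp (M : TMat) : TMat := Matrix.of fun p q => M (q.1, p.2) (p.1, q.2)

open Classical in
/-- Largest eigenvalue of a Hermitian matrix (junk value 0 otherwise). -/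
def lamMax {n : Type*} [Fintype n] [DecidableEq n] (M : Matrix n n ℂ) : ℝ :=
  if h : M.IsHermitian then ⨆ i, h.eigenvalues i else 0

open Classical in
/-- Smallest eigenvalue of a Hermitian matrix (junk value 0 otherwise). -/
def lamMin {n : Type*} [Fintype n] [DecidableEq n] (M : Matrix n n ℂ) : ℝ :=
  if h : M.IsHermitian then ⨅ i, h.eigenvalues i else 0

/-- Negativity N(ρ) = max{0, −2 λ_min(ρ^Γ)}. -/
def negativity (M : TMat) : ℝ := max 0 (-2 * lamMin (ptransp M))

/-- The swap operator V on ℂ²⊗ℂ²: V(eᵢ⊗eⱼ) = eⱼ⊗eᵢ. -/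
def swapM : TMat := Matrix.of fun p q => if p.1 = q.2 ∧ p.2 = q.1 then 1 else 0

/-- The vector √λ|00⟩ + √(1−λ)|11⟩. -/
def xvec (l : ℝ) : TVec := fun p =>
  if p = (0, 0) then (Real.sqrt l : ℂ) else if p = (1, 1) then (Real.sqrt (1 - l) : ℂ) else 0

/-- Kraus operators of the amplitude damping channel with parameter p. -/
def adKraus (p : ℝ) : Fin 2 → QMat :=
  ![!![1, 0; 0, (Real.sqrt (1 - p) : ℂ)], !![0, (Real.sqrt p : ℂ); 0, 0]]

end

theorem mul_outer_mul_conjTranspose (M : TMat) (a : TVec) :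
    M * outer a a * Mᴴ = outer (M *ᵥ a) (M *ᵥ a) := by
  rw [outer, outer, Matrix.mul_vecMulVec, Matrix.vecMulVec_mul, Matrix.star_mulVec]

theorem dotProduct_outer_mulVec (v a : TVec) :
    star v ⬝ᵥ outer a a *ᵥ v = (star v ⬝ᵥ a) * (star a ⬝ᵥ v) := by
  rw [outer, Matrix.dotProduct_mulVec, Matrix.vecMul_vecMulVec, smul_dotProduct, smul_eq_mul]

theorem star_dotProduct_conjTranspose_mulVec (M : TMat) (a b : TVec) :
    star a ⬝ᵥ Mᴴ *ᵥ b = star (M *ᵥ a) ⬝ᵥ b := by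
  rw [Matrix.star_mulVec, Matrix.dotProduct_mulVec]

theorem star_conjTranspose_mulVec_dotProduct (M : TMat) (a b : TVec) :
    star (Mᴴ *ᵥ b) ⬝ᵥ a = star b ⬝ᵥ M *ᵥ a := by
  rw [← star_dotProduct_conjTranspose_mulVec, conjTranspose_conjTranspose]

/-- Operators on the second factor of `phiPlus` can be moved to the first by transposing. -/
theorem kronecker_mulVec_phiPlus (U V : QMat) :
    (U ⊗ₖ V) *ᵥ phiPlus = ((U * Vᵀ) ⊗ₖ (1 : QMat)) *ᵥ phiPlus := by
  ext ⟨i, j⟩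
  fin_cases j <;>
    simp [Matrix.mulVec, dotProduct, Fintype.sum_prod_type, phiPlus, Matrix.mul_apply] <;> ring

/-- for |Φ⟩ = (U⊗V)|Φ⁺⟩ with U, V unitary,
⟨Φ| (id⊗Λ)(|ψ⟩⟨ψ|) |Φ⟩ = ⟨ψ| ((UVᵀ)⊗1) ρ_{Φ⁺,Λ̂} ((UVᵀ)⊗1)ᴴ |ψ⟩. -/
theorem stmt1 {ι : Type*} [Fintype ι] (A : ι → QMat) (hA : IsKraus A)
    (U V : QMat) (hU : Uᴴ * U = 1) (hU' : U * Uᴴ = 1)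
    (hV : Vᴴ * V = 1) (hV' : V * Vᴴ = 1)
    (Φ : TVec) (hΦ : Φ = (U ⊗ₖ V) *ᵥ phiPlus) (ψ : TVec) :
    star Φ ⬝ᵥ (channelOut A (outer ψ ψ)) *ᵥ Φ =
      star ψ ⬝ᵥ (((U * Vᵀ) ⊗ₖ (1 : QMat)) * choiDual A * ((U * Vᵀ) ⊗ₖ (1 : QMat))ᴴ) *ᵥ ψ := by
  have hΦ' : Φ = ((U * Vᵀ) ⊗ₖ (1 : QMat)) *ᵥ phiPlus := by
    rw [hΦ, kronecker_mulVec_phiPlus]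
  simp only [choiDual, channelOut, Matrix.mul_sum, Matrix.sum_mul, Matrix.sum_mulVec,
    dotProduct_sum]
  refine Finset.sum_congr rfl fun i _ => ?_
  have hvec : ((U * Vᵀ) ⊗ₖ (1 : QMat)) *ᵥ (((1 : QMat) ⊗ₖ (A i)ᴴ) *ᵥ phiPlus) =
      ((1 : QMat) ⊗ₖ A i)ᴴ *ᵥ Φ := by
    rw [hΦ', conjTranspose_kronecker, conjTranspose_one, Matrix.mulVec_mulVec,
      Matrix.mulVec_mulVec, ← Matrix.mul_kronecker_mul, ← Matrix.mul_kronecker_mul]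
    simp only [Matrix.mul_one, Matrix.one_mul]
  rw [mul_outer_mul_conjTranspose, mul_outer_mul_conjTranspose, mul_outer_mul_conjTranspose,
    hvec, dotProduct_outer_mulVec, dotProduct_outer_mulVec,
    star_dotProduct_conjTranspose_mulVec, star_conjTranspose_mulVec_dotProduct, mul_comm]
end

section
/- For any qubit channel Λ, any unit vector ψ ∈ ℂ²⊗ℂ², and any maximally entangled unit vector Φ ∈ ℂ²⊗ℂ², the singlet fraction of the output state satisfies ⟨Φ| (id⊗Λ)(|ψ⟩⟨ψ|) |Φ⟩ ≤ λ_max(ρ_{Φ⁺,Λ̂}), the largest eigenvalue of the Choi matrix of the dual channel. -/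
open Matrix
open scoped Kronecker

open scoped ComplexOrder in
theorem Matrix.IsHermitian.re_star_dotProduct_mulVec_le {n : Type*} [Fintype n] [DecidableEq n]
    {M : Matrix n n ℂ} (hM : M.IsHermitian) {r : ℝ} (hr : ∀ i, hM.eigenvalues i ≤ r)
    (x : n → ℂ) : (star x ⬝ᵥ M *ᵥ x).re ≤ r * (star x ⬝ᵥ x).re := by
  have hH : (algebraMap ℝ (Matrix n n ℂ) r - M).IsHermitian :=
    (IsSelfAdjoint.algebraMap _ (IsSelfAdjoint.all r)).sub hM
  have hpos : (algebraMap ℝ (Matrix n n ℂ) r - M).PosSemidef := by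
    rw [hH.posSemidef_iff_eigenvalues_nonneg]
    intro i
    have hi := hH.eigenvalues_mem_spectrum_real i
    rw [← spectrum.singleton_sub_eq, hM.spectrum_real_eq_range_eigenvalues] at hi
    obtain ⟨_, rfl, _, ⟨j, rfl⟩, hj⟩ := Set.mem_sub.mp hi
    rw [← hj]
    exact sub_nonneg.mpr (hr j)
  have hx := (Complex.le_def.mp (hpos.dotProduct_mulVec_nonneg x)).1
  rw [Algebra.algebraMap_eq_smul_one, sub_mulVec, smul_mulVec, one_mulVec, dotProduct_sub,
    dotProduct_smul, Complex.sub_re, Complex.smul_re, smul_eq_mul, Complex.zero_re] at hx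
  linarith

theorem Matrix.IsHermitian.re_star_dotProduct_mulVec_le_lamMax {n : Type*} [Fintype n]
    [DecidableEq n] {M : Matrix n n ℂ} (hM : M.IsHermitian) {x : n → ℂ} (hx : star x ⬝ᵥ x = 1) :
    (star x ⬝ᵥ M *ᵥ x).re ≤ lamMax M := by
  have h := hM.re_star_dotProduct_mulVec_le
    (fun i => le_ciSup (Set.finite_range hM.eigenvalues).bddAbove i) x
  rw [hx, Complex.one_re, mul_one] at h
  rwa [lamMax, dif_pos hM]

theorem channelOut_outer {ι : Type*} [Fintype ι] (A : ι → QMat) (v w : TVec) :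
    channelOut A (outer v w) =
      ∑ i, outer (((1 : QMat) ⊗ₖ A i) *ᵥ v) (((1 : QMat) ⊗ₖ A i) *ᵥ w) := by
  simp only [channelOut, outer, mul_vecMulVec, vecMulVec_mul, star_mulVec]

theorem isHermitian_channelOut_outer {ι : Type*} [Fintype ι] (A : ι → QMat) (v : TVec) :
    (channelOut A (outer v v)).IsHermitian := by
  rw [channelOut_outer]
  simp [outer, IsHermitian, conjTranspose_sum, conjTranspose_vecMulVec]

theorem star_dotProduct_channelOut_outer_mulVec {ι : Type*} [Fintype ι] (A : ι → QMat)
    (u v : TVec) :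
    star u ⬝ᵥ channelOut A (outer v v) *ᵥ u =
      ∑ i, (star u ⬝ᵥ ((1 : QMat) ⊗ₖ A i) *ᵥ v) * star (star u ⬝ᵥ ((1 : QMat) ⊗ₖ A i) *ᵥ v) := by
  rw [channelOut_outer]
  simp only [outer, sum_mulVec, dotProduct_sum, vecMulVec_mulVec,
    dotProduct_smul, MulOpposite.smul_eq_mul_unop, MulOpposite.unop_op]
  refine Finset.sum_congr rfl fun i _ => ?_
  rw [← star_dotProduct]

/-- Conjugating the Kraus operators exchanges the input and the measured vector. -/
theorem star_dotProduct_channelOut_outer_mulVec_conjTranspose {ι : Type*} [Fintype ι]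
    (A : ι → QMat) (u v : TVec) :
    star u ⬝ᵥ channelOut (fun i => (A i)ᴴ) (outer v v) *ᵥ u =
      star v ⬝ᵥ channelOut A (outer u u) *ᵥ v := by
  simp only [star_dotProduct_channelOut_outer_mulVec]
  refine Finset.sum_congr rfl fun i _ => ?_
  have h : star u ⬝ᵥ ((1 : QMat) ⊗ₖ (A i)ᴴ) *ᵥ v =
      star (star v ⬝ᵥ ((1 : QMat) ⊗ₖ A i) *ᵥ u) := by
    rw [← star_dotProduct, star_mulVec, ← dotProduct_mulVec, conjTranspose_kronecker,
      conjTranspose_one]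
  rw [h, star_star, mul_comm]

/-- A local operator on the first factor moves from the measured vector to the input. -/
theorem star_dotProduct_channelOut_outer_kronecker_one_mulVec {ι : Type*} [Fintype ι]
    (A : ι → QMat) (U : QMat) (u v : TVec) :
    star ((U ⊗ₖ (1 : QMat)) *ᵥ u) ⬝ᵥ channelOut A (outer v v) *ᵥ ((U ⊗ₖ (1 : QMat)) *ᵥ u) =
      star u ⬝ᵥ channelOut A (outer ((Uᴴ ⊗ₖ (1 : QMat)) *ᵥ v) ((Uᴴ ⊗ₖ (1 : QMat)) *ᵥ v)) *ᵥ u := by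
  have h (i : ι) : star ((U ⊗ₖ (1 : QMat)) *ᵥ u) ⬝ᵥ ((1 : QMat) ⊗ₖ A i) *ᵥ v =
      star u ⬝ᵥ ((1 : QMat) ⊗ₖ A i) *ᵥ ((Uᴴ ⊗ₖ (1 : QMat)) *ᵥ v) := by
    rw [star_mulVec, ← dotProduct_mulVec, mulVec_mulVec, mulVec_mulVec, conjTranspose_kronecker,
      conjTranspose_one, ← mul_kronecker_mul, ← mul_kronecker_mul]
    simp only [Matrix.mul_one, Matrix.one_mul]
  simp only [star_dotProduct_channelOut_outer_mulVec, h]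

/-- Every maximally entangled vector is a local unitary image of `phiPlus`. -/
theorem MaxEnt.exists_kronecker_one_mulVec_phiPlus {Φ : TVec} (hΦ : MaxEnt Φ) :
    ∃ U : QMat, U * Uᴴ = 1 ∧ Φ = (U ⊗ₖ (1 : QMat)) *ᵥ phiPlus := by
  have hs : (Real.sqrt 2 : ℂ) ≠ 0 := by simp
  have hs2 : (Real.sqrt 2 : ℂ) * (Real.sqrt 2 : ℂ) = 2 := by
    rw [← Complex.ofReal_mul, Real.mul_self_sqrt zero_le_two, Complex.ofReal_ofNat]
  refine ⟨Matrix.of fun i k => (Real.sqrt 2 : ℂ) * Φ (i, k), ?_, ?_⟩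
  · ext i j
    have h := congrFun (congrFun hΦ i) j
    simp only [ptraceB, outer, of_apply, vecMulVec_apply, Pi.star_apply, Matrix.smul_apply,
      smul_eq_mul] at h
    calc ∑ k, (Real.sqrt 2 : ℂ) * Φ (i, k) * star ((Real.sqrt 2 : ℂ) * Φ (j, k))
        = ∑ k, (Real.sqrt 2 * Real.sqrt 2 : ℂ) * (Φ (i, k) * star (Φ (j, k))) := by
          refine Finset.sum_congr rfl fun k _ => ?_
          rw [star_mul', Complex.star_def, Complex.conj_ofReal, mul_mul_mul_comm]
      _ = (1 : QMat) i j := by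
          rw [← Finset.mul_sum, h, hs2]
          ring
  · ext ⟨i, k⟩
    simp only [mulVec, dotProduct, Fintype.sum_prod_type, kroneckerMap_apply, of_apply, phiPlus,
      one_apply]
    simp only [mul_ite, ite_mul, mul_one, mul_zero, zero_mul, Finset.sum_ite_eq,
      Finset.mem_univ, if_true]
    field_simp

/-- the singlet fraction of any output state is at most the largest
eigenvalue of the Choi matrix of the dual channel. -/
theorem stmt2 {ι : Type*} [Fintype ι] (A : ι → QMat) (hA : IsKraus A)
    (ψ : TVec) (hψ : IsUnitVec ψ)
    (Φ : TVec) (hΦu : IsUnitVec Φ) (hΦ : MaxEnt Φ) :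
    (star Φ ⬝ᵥ (channelOut A (outer ψ ψ)) *ᵥ Φ).re ≤ lamMax (choiDual A) := by
  obtain ⟨U, hU, rfl⟩ := hΦ.exists_kronecker_one_mulVec_phiPlus
  rw [star_dotProduct_channelOut_outer_kronecker_one_mulVec,
    ← star_dotProduct_channelOut_outer_mulVec_conjTranspose]
  refine (isHermitian_channelOut_outer _ _).re_star_dotProduct_mulVec_le_lamMax ?_
  rw [star_mulVec, ← dotProduct_mulVec, mulVec_mulVec, conjTranspose_kronecker,
    conjTranspose_conjTranspose, conjTranspose_one, ← mul_kronecker_mul, hU, Matrix.one_mul,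
    one_kronecker_one, one_mulVec]
  exact hψ
end

section
/- Let Λ be a qubit channel and let ψ₀ be a unit eigenvector of ρ_{Φ⁺,Λ̂} corresponding to its largest eigenvalue. Then ⟨Φ⁺| (id⊗Λ)(|ψ₀⟩⟨ψ₀|) |Φ⁺⟩ = λ_max(ρ_{Φ⁺,Λ̂}); i.e., transmitting one half of the state ψ₀ through Λ produces a state whose overlap with |Φ⁺⟩ equals the largest eigenvalue of the Choi matrix of the dual channel. -/
open Matrix
open scoped Kronecker

/-- The quadratic form of a conjugated rank-one operator factorizes. -/
theorem star_dotProduct_conj_outer_mulVec (K : TMat) (ψ φ : TVec) :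
    star φ ⬝ᵥ (K * outer ψ ψ * Kᴴ) *ᵥ φ = (star φ ⬝ᵥ K *ᵥ ψ) * (star ψ ⬝ᵥ Kᴴ *ᵥ φ) := by
  rw [← mulVec_mulVec, ← mulVec_mulVec, outer, vecMulVec_mulVec, mulVec_smul, dotProduct_smul]
  simp

/-- Duality: `⟨φ|(id⊗Λ)(|ψ⟩⟨ψ|)|φ⟩ = ⟨ψ|(id⊗Λ̂)(|φ⟩⟨φ|)|ψ⟩`. -/
theorem channelOut_outer_duality {ι : Type*} [Fintype ι] (A : ι → QMat) (ψ φ : TVec) :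
    star φ ⬝ᵥ (channelOut A (outer ψ ψ)) *ᵥ φ =
      star ψ ⬝ᵥ (channelOut (fun i => (A i)ᴴ) (outer φ φ)) *ᵥ ψ := by
  simp only [channelOut, sum_mulVec, dotProduct_sum, star_dotProduct_conj_outer_mulVec]
  refine Finset.sum_congr rfl fun i _ => ?_
  rw [mul_comm]
  simp [conjTranspose_kronecker]

/-- transmitting half of a top eigenvector ψ₀ of ρ_{Φ⁺,Λ̂} gives overlap
with |Φ⁺⟩ equal to λ_max(ρ_{Φ⁺,Λ̂}). -/
theorem stmt3 {ι : Type*} [Fintype ι] (A : ι → QMat) (hA : IsKraus A)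
    (ψ₀ : TVec) (hψ₀ : IsUnitVec ψ₀)
    (heig : (choiDual A) *ᵥ ψ₀ = (lamMax (choiDual A) : ℂ) • ψ₀) :
    star phiPlus ⬝ᵥ (channelOut A (outer ψ₀ ψ₀)) *ᵥ phiPlus =
      (lamMax (choiDual A) : ℂ) := by
  rw [channelOut_outer_duality]
  change star ψ₀ ⬝ᵥ (choiDual A) *ᵥ ψ₀ = _
  rw [heig, dotProduct_smul, show star ψ₀ ⬝ᵥ ψ₀ = 1 from hψ₀, smul_eq_mul, mul_one]
end

section
/- (Optimal pre-processed singlet fraction.) For any qubit channel Λ, the supremum over all unit vectors ψ ∈ ℂ²⊗ℂ² and all maximally entangled unit vectors Φ ∈ ℂ²⊗ℂ² of Re⟨Φ| (id⊗Λ)(|ψ⟩⟨ψ|) |Φ⟩ is equal to λ_max(ρ_{Φ⁺,Λ}), the largest eigenvalue of the Choi matrix of Λ, and this supremum is attained. -/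
open Matrix
open scoped Kronecker

theorem sqrt_two_mul_self : (Real.sqrt 2 : ℂ) * (Real.sqrt 2 : ℂ) = 2 := by
  rw [← Complex.ofReal_mul, Real.mul_self_sqrt zero_le_two, Complex.ofReal_ofNat]

theorem sqrt_two_mul_self_inv : (Real.sqrt 2 : ℂ)⁻¹ * (Real.sqrt 2 : ℂ)⁻¹ = 2⁻¹ := by
  rw [← mul_inv, sqrt_two_mul_self]

theorem IsUnitVec.iff_sum_normSq {ψ : TVec} :
    IsUnitVec ψ ↔ ∑ p, Complex.normSq (ψ p) = 1 := by
  rw [IsUnitVec, ← Complex.ofReal_inj]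
  simp [dotProduct, Complex.normSq_eq_conj_mul_self]

theorem quadForm_outer (B : TMat) (φ ψ : TVec) :
    star φ ⬝ᵥ (B * outer ψ ψ * Bᴴ) *ᵥ φ = Complex.normSq (star φ ⬝ᵥ B *ᵥ ψ) := by
  have h : B * outer ψ ψ * Bᴴ = vecMulVec (B *ᵥ ψ) (star (B *ᵥ ψ)) := by
    rw [outer, mul_vecMulVec, vecMulVec_mul, star_mulVec]
  rw [h, vecMulVec_mulVec, Complex.normSq_eq_conj_mul_self, dotProduct_smul,
    star_dotProduct, op_smul_eq_mul, starRingEnd_apply, mul_comm]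

theorem re_quadForm_channelOut {ι : Type*} [Fintype ι] (A : ι → QMat) (φ ψ : TVec) :
    (star φ ⬝ᵥ channelOut A (outer ψ ψ) *ᵥ φ).re =
      ∑ i, Complex.normSq (star φ ⬝ᵥ ((1 : QMat) ⊗ₖ A i) *ᵥ ψ) := by
  rw [channelOut, sum_mulVec, dotProduct_sum, Complex.re_sum]
  exact Finset.sum_congr rfl fun i _ => by rw [quadForm_outer, Complex.ofReal_re]

theorem isHermitian_channelOut {ι : Type*} [Fintype ι] (A : ι → QMat) {M : TMat}
    (hM : M.IsHermitian) : (channelOut A M).IsHermitian := by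
  simp only [IsHermitian, channelOut, conjTranspose_sum]
  exact Finset.sum_congr rfl fun i _ => isHermitian_mul_mul_conjTranspose _ hM

theorem isHermitian_choi {ι : Type*} [Fintype ι] (A : ι → QMat) : (choi A).IsHermitian := by
  refine isHermitian_channelOut A ?_
  simp [IsHermitian, outer, conjTranspose_vecMulVec]

theorem re_quadForm_le_lamMax {M : TMat} (hM : M.IsHermitian) {v : TVec} (hv : IsUnitVec v) :
    (star v ⬝ᵥ M *ᵥ v).re ≤ lamMax M := by
  rw [lamMax, dif_pos hM]
  set b := hM.eigenvectorBasis
  have hcoef (i) : inner ℂ (b i) (WithLp.toLp 2 (M *ᵥ v)) =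
      hM.eigenvalues i * inner ℂ (b i) (WithLp.toLp 2 v) := by
    have hb : star (b i).ofLp ᵥ* M = (hM.eigenvalues i : ℂ) • star (b i).ofLp := by
      have := congrArg star (hM.mulVec_eigenvectorBasis i)
      rw [star_mulVec, hM.eq] at this
      rw [this]
      ext
      simp [b]
    simp only [EuclideanSpace.inner_eq_star_dotProduct]
    rw [dotProduct_comm, dotProduct_mulVec, hb, smul_dotProduct, dotProduct_comm, smul_eq_mul]
  have hquad : star v ⬝ᵥ M *ᵥ v =
      ((∑ i, hM.eigenvalues i * Complex.normSq (inner ℂ (b i) (WithLp.toLp 2 v)) : ℝ) : ℂ) := by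
    have := b.sum_inner_mul_inner (WithLp.toLp 2 v) (WithLp.toLp 2 (M *ᵥ v))
    rw [EuclideanSpace.inner_eq_star_dotProduct, dotProduct_comm] at this
    rw [← this]
    push_cast
    refine Finset.sum_congr rfl fun i _ => ?_
    rw [hcoef, Complex.normSq_eq_conj_mul_self, inner_conj_symm]
    ring
  have hnorm : ∑ i, Complex.normSq (inner ℂ (b i) (WithLp.toLp 2 v)) = 1 := by
    have := b.sum_inner_mul_inner (WithLp.toLp 2 v) (WithLp.toLp 2 v)
    rw [EuclideanSpace.inner_eq_star_dotProduct, dotProduct_comm, hv] at this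
    rw [← Complex.ofReal_inj, Complex.ofReal_one, ← this]
    push_cast
    refine Finset.sum_congr rfl fun i _ => ?_
    rw [Complex.normSq_eq_conj_mul_self, inner_conj_symm]
  rw [hquad, Complex.ofReal_re, ← mul_one (⨆ i, _), ← hnorm, Finset.mul_sum]
  gcongr with i
  · exact Complex.normSq_nonneg _
  · exact le_ciSup (Set.finite_range _).bddAbove i

theorem exists_re_quadForm_eq_lamMax {M : TMat} (hM : M.IsHermitian) :
    ∃ v : TVec, IsUnitVec v ∧ (star v ⬝ᵥ M *ᵥ v).re = lamMax M := by
  rw [lamMax, dif_pos hM]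
  obtain ⟨i, hi⟩ := exists_eq_ciSup_of_finite (f := hM.eigenvalues)
  have hu : IsUnitVec (hM.eigenvectorBasis i).ofLp := by
    rw [IsUnitVec, dotProduct_comm, ← EuclideanSpace.inner_eq_star_dotProduct]
    simp
  refine ⟨_, hu, ?_⟩
  rw [hM.mulVec_eigenvectorBasis, dotProduct_smul, hu, ← hi]
  simp

/-- In terms of the coefficient matrices `P`, `Q` of `Φ`, `ψ`, the vector of `√2 (P† Q)†`. -/
noncomputable def twist (Φ ψ : TVec) : TVec := fun p =>
  (Real.sqrt 2 : ℂ) * ∑ j, Φ (j, p.2) * star (ψ (j, p.1))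

theorem overlap_twist (Φ ψ : TVec) (B : QMat) :
    star (twist Φ ψ) ⬝ᵥ ((1 : QMat) ⊗ₖ B) *ᵥ phiPlus = star Φ ⬝ᵥ ((1 : QMat) ⊗ₖ B) *ᵥ ψ := by
  have h2 : (Real.sqrt 2 : ℂ) * (Real.sqrt 2 : ℂ)⁻¹ = 1 :=
    mul_inv_cancel₀ (by simp)
  simp [twist, phiPlus, dotProduct, mulVec, Fintype.sum_prod_type, Fin.sum_univ_two,
    kroneckerMap_apply, one_apply]
  linear_combination (starRingEnd ℂ (Φ (0, 0)) * B 0 0 * ψ (0, 0) +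
    starRingEnd ℂ (Φ (0, 0)) * B 0 1 * ψ (0, 1) +
    starRingEnd ℂ (Φ (0, 1)) * B 1 0 * ψ (0, 0) +
    starRingEnd ℂ (Φ (0, 1)) * B 1 1 * ψ (0, 1) +
    starRingEnd ℂ (Φ (1, 0)) * B 0 0 * ψ (1, 0) +
    starRingEnd ℂ (Φ (1, 0)) * B 0 1 * ψ (1, 1) +
    starRingEnd ℂ (Φ (1, 1)) * B 1 0 * ψ (1, 0) +
    starRingEnd ℂ (Φ (1, 1)) * B 1 1 * ψ (1, 1)) * h2

theorem MaxEnt.isUnitVec_twist {Φ ψ : TVec} (hΦ : MaxEnt Φ) (hψ : IsUnitVec ψ) :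
    IsUnitVec (twist Φ ψ) := by
  have hP (i j) := congrFun (congrFun hΦ i) j
  have h00 := hP 0 0
  have h01 := hP 0 1
  have h10 := hP 1 0
  have h11 := hP 1 1
  simp [ptraceB, outer, vecMulVec_apply] at h00 h01 h10 h11
  simp [IsUnitVec, dotProduct, Fintype.sum_prod_type] at hψ
  simp [IsUnitVec, twist, dotProduct, Fintype.sum_prod_type]
  ring_nf
  rw [pow_two, sqrt_two_mul_self]
  linear_combination hψ +
    2 * (ψ (0, 0) * starRingEnd ℂ (ψ (0, 0)) + ψ (0, 1) * starRingEnd ℂ (ψ (0, 1))) * h00 +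
    2 * (ψ (0, 0) * starRingEnd ℂ (ψ (1, 0)) + ψ (0, 1) * starRingEnd ℂ (ψ (1, 1))) * h10 +
    2 * (ψ (1, 0) * starRingEnd ℂ (ψ (0, 0)) + ψ (1, 1) * starRingEnd ℂ (ψ (0, 1))) * h01 +
    2 * (ψ (1, 0) * starRingEnd ℂ (ψ (1, 0)) + ψ (1, 1) * starRingEnd ℂ (ψ (1, 1))) * h11

theorem twist_phiPlus (v : TVec) : twist phiPlus (fun p => star (v p.swap)) = v := by
  ext ⟨k, l⟩
  fin_cases l <;> simp [twist, phiPlus]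

theorem isUnitVec_phiPlus : IsUnitVec phiPlus := by
  simp [IsUnitVec, phiPlus, dotProduct, Fintype.sum_prod_type]
  rw [sqrt_two_mul_self_inv]
  norm_num

theorem maxEnt_phiPlus : MaxEnt phiPlus := by
  ext i j
  fin_cases i <;> fin_cases j <;> simp [ptraceB, outer, vecMulVec_apply, phiPlus]
  all_goals exact sqrt_two_mul_self_inv

/-- optimal pre-processed singlet fraction: the supremum over all unit
vectors ψ and maximally entangled unit vectors Φ of Re⟨Φ|(id⊗Λ)(|ψ⟩⟨ψ|)|Φ⟩ equals
λ_max(ρ_{Φ⁺,Λ}) and is attained. -/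
theorem stmt4 {ι : Type*} [Fintype ι] (A : ι → QMat) (hA : IsKraus A) :
    IsGreatest {r : ℝ | ∃ ψ Φ : TVec, IsUnitVec ψ ∧ IsUnitVec Φ ∧ MaxEnt Φ ∧
      r = (star Φ ⬝ᵥ (channelOut A (outer ψ ψ)) *ᵥ Φ).re} (lamMax (choi A)) := by
  have key (Φ ψ : TVec) : (star Φ ⬝ᵥ channelOut A (outer ψ ψ) *ᵥ Φ).re =
      (star (twist Φ ψ) ⬝ᵥ choi A *ᵥ twist Φ ψ).re := by
    simp only [choi, re_quadForm_channelOut, overlap_twist]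
  constructor
  · obtain ⟨v, hv, h⟩ := exists_re_quadForm_eq_lamMax (isHermitian_choi A)
    refine ⟨fun p => star (v p.swap), phiPlus, ?_, isUnitVec_phiPlus, maxEnt_phiPlus, ?_⟩
    · rw [IsUnitVec.iff_sum_normSq] at hv ⊢
      rw [← hv, ← Equiv.sum_comp (Equiv.prodComm _ _)]
      simp
    · rw [key, twist_phiPlus, h]
  · rintro r ⟨ψ, Φ, hψ, -, hΦ, rfl⟩
    rw [key]
    exact re_quadForm_le_lamMax (isHermitian_choi A) (hΦ.isUnitVec_twist hψ)
end

section
/- Let Λ be a qubit channel, let ψ ∈ ℂ²⊗ℂ² be a unit vector, and let t ∈ ℝ with ρ_{Φ⁺,Λ} ψ = t·ψ. Then the vector (V†ψ)* is a unit vector satisfying ρ_{Φ⁺,Λ̂} ((V†ψ)*) = t·((V†ψ)*); moreover ψ is maximally entangled if and only if (V†ψ)* is maximally entangled. -/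
open Matrix
open scoped Kronecker

theorem star_swapM_mulVec (ψ : TVec) :
    star (swapMᴴ *ᵥ ψ) = fun p => star (ψ p.swap) := by
  ext ⟨i, j⟩
  fin_cases i <;> fin_cases j <;>
    simp [swapM, mulVec, dotProduct, Fintype.sum_prod_type, conjTranspose_apply]

theorem one_kronecker_mulVec_phiPlus (B : QMat) (i k : Fin 2) :
    (((1 : QMat) ⊗ₖ B) *ᵥ phiPlus) (i, k) = B k i * ((Real.sqrt 2 : ℂ))⁻¹ := by
  simp [mulVec, dotProduct, phiPlus, Fintype.sum_prod_type, one_apply]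

theorem choi_apply {ι : Type*} [Fintype ι] (A : ι → QMat) (i k j l : Fin 2) :
    choi A (i, k) (j, l) = (1 / 2) * ∑ a, A a k i * star (A a l j) := by
  have hs : ((Real.sqrt 2 : ℂ))⁻¹ * ((Real.sqrt 2 : ℂ))⁻¹ = 1 / 2 := by
    rw [← mul_inv, ← Complex.ofReal_mul, Real.mul_self_sqrt (by norm_num)]
    norm_num
  have hterm (a : ι) : (((1 : QMat) ⊗ₖ A a) * outer phiPlus phiPlus * ((1 : QMat) ⊗ₖ A a)ᴴ)
      (i, k) (j, l) = (1 / 2) * (A a k i * star (A a l j)) := by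
    rw [outer, mul_vecMulVec, vecMulVec_mul, ← star_mulVec, vecMulVec_apply, Pi.star_apply,
      one_kronecker_mulVec_phiPlus, one_kronecker_mulVec_phiPlus, ← hs]
    simp only [star_mul', star_inv₀, Complex.star_def, Complex.conj_ofReal]
    ring
  rw [choi, channelOut, Matrix.sum_apply, Finset.mul_sum]
  exact Finset.sum_congr rfl fun a _ => hterm a

theorem choiDual_apply {ι : Type*} [Fintype ι] (A : ι → QMat) (i k j l : Fin 2) :
    choiDual A (i, k) (j, l) = star (choi A (k, i) (l, j)) := by
  change choi (fun a => (A a)ᴴ) (i, k) (j, l) = _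
  simp [choi_apply, conjTranspose_apply]

/-- A bipartite vector is maximally entangled iff its coefficient matrix `M` satisfies
`M * Mᴴ = 1/2`. -/
theorem maxEnt_iff_coeff (ψ : TVec) :
    MaxEnt ψ ↔ (of fun i j => ψ (i, j) : QMat) * (of fun i j => ψ (i, j) : QMat)ᴴ
      = (1 / 2 : ℂ) • 1 := by
  have h : ptraceB (outer ψ ψ) =
      (of fun i j => ψ (i, j) : QMat) * (of fun i j => ψ (i, j) : QMat)ᴴ := by
    ext i j
    simp [ptraceB, outer, vecMulVec_apply, Matrix.mul_apply]
  rw [MaxEnt, h]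

theorem mul_eq_half_comm (M N : QMat) :
    M * N = (1 / 2 : ℂ) • 1 ↔ N * M = (1 / 2 : ℂ) • 1 := by
  have key (P Q : QMat) : P * Q = (1 / 2 : ℂ) • 1 ↔ ((2 : ℂ) • P) * Q = 1 := by
    rw [smul_mul_assoc, one_div, eq_inv_smul_iff₀ two_ne_zero]
  rw [key, mul_eq_one_comm, key, mul_smul_comm, smul_mul_assoc]

/-- if ψ is a unit eigenvector of ρ_{Φ⁺,Λ} with real eigenvalue t, then
(V†ψ)* is a unit eigenvector of ρ_{Φ⁺,Λ̂} with the same eigenvalue, and ψ is maximally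
entangled iff (V†ψ)* is. -/
theorem stmt7 {ι : Type*} [Fintype ι] (A : ι → QMat) (hA : IsKraus A)
    (ψ : TVec) (hψ : IsUnitVec ψ) (t : ℝ)
    (heig : (choi A) *ᵥ ψ = (t : ℂ) • ψ) :
    IsUnitVec (star ((swapM)ᴴ *ᵥ ψ)) ∧
    (choiDual A) *ᵥ (star ((swapM)ᴴ *ᵥ ψ)) = (t : ℂ) • (star ((swapM)ᴴ *ᵥ ψ)) ∧
    (MaxEnt ψ ↔ MaxEnt (star ((swapM)ᴴ *ᵥ ψ))) := by
  rw [star_swapM_mulVec]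
  refine ⟨?_, ?_, ?_⟩
  · rw [IsUnitVec, ← hψ]
    simp only [dotProduct, Fintype.sum_prod_type, Pi.star_apply, Prod.swap_prod_mk, star_star]
    rw [Finset.sum_comm]
    exact Finset.sum_congr rfl fun i _ => Finset.sum_congr rfl fun j _ => mul_comm _ _
  · ext ⟨i, k⟩
    have h := congrArg star (congrFun heig (k, i))
    simp only [mulVec, dotProduct, Fintype.sum_prod_type, Pi.smul_apply, smul_eq_mul, star_sum,
      star_mul', Complex.star_def, Complex.conj_ofReal] at h
    simp only [mulVec, dotProduct, Fintype.sum_prod_type, Pi.smul_apply, smul_eq_mul,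
      choiDual_apply, Prod.swap_prod_mk, Complex.star_def]
    rw [← h, Finset.sum_comm]
  · have hM : (of fun i j => star (ψ (Prod.swap (i, j))) : QMat)
        = (of fun i j => ψ (i, j) : QMat)ᴴ := rfl
    rw [maxEnt_iff_coeff, maxEnt_iff_coeff, hM, conjTranspose_conjTranspose, mul_eq_half_comm]
end

section
/- Let σ be a 4×4 positive semidefinite Hermitian complex matrix (indexed by Fin 2 × Fin 2) with trace 1 and whose partial trace over the second factor equals (1/2)·1. Then λ_min(σ^Γ) + λ_max(σ) = 1/2, where σ^Γ is the partial transpose of σ on the first factor. -/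
open Matrix
open scoped Kronecker ComplexOrder

namespace Matrix.IsHermitian

variable {n : Type*} [Fintype n] [DecidableEq n] {M : Matrix n n ℂ}

theorem lamMax_eq_sSup_spectrum (h : M.IsHermitian) : lamMax M = sSup (spectrum ℝ M) := by
  rw [lamMax, dif_pos h, h.spectrum_real_eq_range_eigenvalues, sSup_range]

theorem lamMin_eq_sInf_spectrum (h : M.IsHermitian) : lamMin M = sInf (spectrum ℝ M) := by
  rw [lamMin, dif_pos h, h.spectrum_real_eq_range_eigenvalues, sInf_range]

theorem ptransp {M : TMat} (h : M.IsHermitian) : (ptransp M).IsHermitian := by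
  ext p q
  exact h.apply _ _

end Matrix.IsHermitian

/-- The spin flip `1 ⊗ iσ_y` on the second factor. -/
def spinFlip : TMat := (1 : QMat) ⊗ₖ !![0, 1; -1, 0]

theorem spinFlip_mul_transpose : spinFlip * spinFlipᵀ = 1 := by
  rw [spinFlip, ← kroneckerMap_transpose, ← mul_kronecker_mul, ← one_kronecker_one]
  congr 1
  · simp
  · ext i j
    fin_cases i <;> fin_cases j <;> simp [Matrix.mul_apply]

/-- The reduction identity: transposing a 2×2 matrix `X` is, up to the spin flip,
`X ↦ tr X - X`. -/
theorem transpose_ptransp (M : TMat) :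
    (ptransp M)ᵀ = spinFlip * (ptraceB M ⊗ₖ (1 : QMat) - M) * spinFlipᵀ := by
  ext ⟨i, k⟩ ⟨j, l⟩
  fin_cases i <;> fin_cases j <;> fin_cases k <;> fin_cases l <;>
    simp [ptransp, ptraceB, spinFlip, Matrix.mul_apply, Fintype.sum_prod_type,
      Matrix.one_apply]

theorem det_sub_ptransp {M : TMat} (hM : ptraceB M = (1/2 : ℂ) • 1) (r : ℝ) :
    (algebraMap ℝ TMat r - ptransp M).det = (algebraMap ℝ TMat (1/2 - r) - M).det := by
  have key : (algebraMap ℝ TMat r - ptransp M)ᵀ =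
      spinFlip * (-(algebraMap ℝ TMat (1/2 - r) - M)) * spinFlipᵀ := by
    have hr : algebraMap ℝ TMat r = spinFlip * algebraMap ℝ TMat r * spinFlipᵀ := by
      rw [← Algebra.commutes, mul_assoc, spinFlip_mul_transpose, mul_one]
    have ht : (algebraMap ℝ TMat r)ᵀ = algebraMap ℝ TMat r := by
      simp [Algebra.algebraMap_eq_smul_one]
    have hh : ptraceB M ⊗ₖ (1 : QMat) = algebraMap ℝ TMat (1/2) := by
      rw [hM, smul_kronecker, one_kronecker_one, Algebra.algebraMap_eq_smul_one]
      ext p q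
      simp [Matrix.one_apply]
    rw [transpose_sub, ht, transpose_ptransp, hh, map_sub]
    nth_rewrite 1 [hr]
    noncomm_ring
  have hdet : spinFlip.det * spinFlipᵀ.det = 1 := by
    rw [← det_mul, spinFlip_mul_transpose, det_one]
  rw [← det_transpose, key, det_mul, det_mul, mul_right_comm, hdet, one_mul, det_neg,
    Even.neg_one_pow (by decide), one_mul]

theorem mem_spectrum_ptransp {M : TMat} (hM : ptraceB M = (1/2 : ℂ) • 1) (r : ℝ) :
    r ∈ spectrum ℝ (ptransp M) ↔ 1/2 - r ∈ spectrum ℝ M := by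
  rw [spectrum.mem_iff, spectrum.mem_iff, isUnit_iff_isUnit_det, isUnit_iff_isUnit_det,
    det_sub_ptransp hM]

/-- for a two-qubit state σ with Tr_B σ = (1/2)·1,
λ_min(σ^Γ) + λ_max(σ) = 1/2. -/
theorem stmt8 (σ : TMat) (hσ : σ.PosSemidef) (htr : σ.trace = 1)
    (hpt : ptraceB σ = (1/2 : ℂ) • 1) :
    lamMin (ptransp σ) + lamMax σ = 1/2 := by
  have hspec : spectrum ℝ (ptransp σ) = (fun x => 1/2 - x) '' spectrum ℝ σ := by
    ext r
    rw [mem_spectrum_ptransp hpt]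
    exact ⟨fun h => ⟨_, h, sub_sub_cancel _ _⟩, by rintro ⟨x, hx, rfl⟩; simpa using hx⟩
  have hH := hσ.isHermitian
  rw [hH.ptransp.lamMin_eq_sInf_spectrum, hspec, hH.lamMax_eq_sSup_spectrum,
    hH.spectrum_real_eq_range_eigenvalues]
  have hanti : Antitone fun x : ℝ => 1/2 - x := fun _ _ h => sub_le_sub_left h _
  rw [← hanti.map_csSup_of_continuousAt (by fun_prop) (Set.range_nonempty _)
    (Set.finite_range _).bddAbove]
  ring
end

section
/- Let σ be a 4×4 positive semidefinite Hermitian complex matrix (indexed by Fin 2 × Fin 2) with trace 1 and whose partial trace over the second factor equals (1/2)·1. Then the characteristic polynomials of σ^Γ and σ are related by det(σ^Γ − x·1) = det(σ − (1/2 − x)·1) for every x ∈ ℂ; equivalently, the eigenvalues of σ^Γ are exactly 1/2 minus the eigenvalues of σ (with multiplicity). -/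
open Matrix
open scoped Kronecker ComplexOrder

/-- Conjugating the transpose of `M^Γ`, i.e. the partial transpose on the second factor, by
`1 ⊗ J` with `J = !![0, 1; -1, 0]` gives `c • 1 - M` when the partial trace of `M` over the
second factor is `c • 1`. -/
theorem kronecker_conj_transpose_ptransp (M : TMat) (c : ℂ) (h : ptraceB M = c • 1) :
    ((1 : QMat) ⊗ₖ !![0, 1; -1, 0]) * (ptransp M)ᵀ * ((1 : QMat) ⊗ₖ !![0, 1; -1, 0])ᵀ
      = c • 1 - M := by
  have h00 := congrFun₂ h 0 0
  have h01 := congrFun₂ h 0 1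
  have h10 := congrFun₂ h 1 0
  have h11 := congrFun₂ h 1 1
  simp [ptraceB, Fin.sum_univ_two] at h00 h01 h10 h11
  ext ⟨i, k⟩ ⟨j, l⟩
  fin_cases i <;> fin_cases k <;> fin_cases j <;> fin_cases l <;>
    simp [Matrix.mul_apply, Fintype.sum_prod_type, Fin.sum_univ_two, ptransp,
      Matrix.one_apply] <;>
    grind

theorem kronecker_mul_transpose_eq_one :
    ((1 : QMat) ⊗ₖ !![0, 1; -1, 0]) * ((1 : QMat) ⊗ₖ !![0, 1; -1, 0])ᵀ = (1 : TMat) := by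
  ext ⟨i, k⟩ ⟨j, l⟩
  fin_cases i <;> fin_cases k <;> fin_cases j <;> fin_cases l <;>
    simp [Matrix.mul_apply, Fintype.sum_prod_type, Fin.sum_univ_two, Matrix.one_apply]

/-- for a two-qubit state σ with Tr_B σ = (1/2)·1, the characteristic
polynomials satisfy det(σ^Γ − x·1) = det(σ − (1/2 − x)·1) for all x ∈ ℂ. -/
theorem stmt9 (σ : TMat) (hσ : σ.PosSemidef) (htr : σ.trace = 1)
    (hpt : ptraceB σ = (1/2 : ℂ) • 1) :
    ∀ x : ℂ, (ptransp σ - x • 1).det = (σ - ((1/2 : ℂ) - x) • 1).det := by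
  intro x
  have hconj := kronecker_conj_transpose_ptransp σ _ hpt
  have hone := kronecker_mul_transpose_eq_one
  set W : TMat := (1 : QMat) ⊗ₖ !![0, 1; -1, 0]
  have key : W * (ptransp σ - x • 1)ᵀ * Wᵀ = -(σ - ((1/2 : ℂ) - x) • 1) := by
    rw [transpose_sub, transpose_smul, transpose_one, mul_sub, sub_mul, hconj,
      mul_smul_comm, mul_one, smul_mul_assoc, hone]
    module
  have hdet : W.det * W.det = 1 := by
    simpa only [det_mul, det_transpose, det_one] using congrArg det hone
  have hd := congrArg det key
  rw [det_neg, det_mul, det_mul, det_transpose, det_transpose, mul_right_comm, hdet,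
    one_mul] at hd
  rw [hd, Fintype.card_prod, Fintype.card_fin, Even.neg_one_pow (by decide), one_mul]
end

section
/- Let A₀, A₁, …, Aₙ be 2×2 complex matrices such that A₀ = c·1 for some c ∈ ℂ, Tr(Aₖ) = 0 for all k ≥ 1, and ∑ₖ Aₖ†Aₖ = 1. Then ∑ₖ AₖAₖ† = 1. (Key algebraic step: any Kraus family consisting of a scalar multiple of the identity together with traceless operators that defines a trace-preserving map is automatically unital.) -/
open Matrix
open scoped Kronecker

/-- For a traceless 2×2 matrix the anticommutator with its adjoint is scalar. -/
theorem conjTranspose_mul_add_mul_conjTranspose_of_trace_eq_zero (B : QMat)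
    (hB : B.trace = 0) : Bᴴ * B + B * Bᴴ = (Bᴴ * B).trace • (1 : QMat) := by
  rw [Matrix.trace_fin_two] at hB
  have h : B 1 1 = -B 0 0 := by linear_combination hB
  ext i j
  fin_cases i <;> fin_cases j <;>
    simp [Matrix.mul_apply, Matrix.trace_fin_two, Fin.sum_univ_two, h] <;> ring

/-- For a scalar 2×2 matrix the anticommutator with its adjoint is given by the same trace. -/
theorem conjTranspose_mul_add_mul_conjTranspose_smul_one (c : ℂ) :
    (c • (1 : QMat))ᴴ * (c • (1 : QMat)) + (c • (1 : QMat)) * (c • (1 : QMat))ᴴ =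
      ((c • (1 : QMat))ᴴ * (c • (1 : QMat))).trace • (1 : QMat) := by
  ext i j
  fin_cases i <;> fin_cases j <;> simp <;> ring

/-- a Kraus family consisting of a scalar multiple of the identity together
with traceless operators, which defines a trace-preserving map, is automatically unital. -/
theorem stmt12 (n : ℕ) (A : Fin (n + 1) → QMat) (c : ℂ)
    (h0 : A 0 = c • (1 : QMat))
    (htr : ∀ k, k ≠ 0 → (A k).trace = 0)
    (hK : ∑ k, (A k)ᴴ * A k = 1) :
    ∑ k, A k * (A k)ᴴ = 1 := by
  have key : ∀ k, (A k)ᴴ * A k + A k * (A k)ᴴ = ((A k)ᴴ * A k).trace • (1 : QMat) := by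
    intro k
    by_cases hk : k = 0
    · rw [hk, h0]
      exact conjTranspose_mul_add_mul_conjTranspose_smul_one c
    · exact conjTranspose_mul_add_mul_conjTranspose_of_trace_eq_zero (A k) (htr k hk)
  have hsum : 1 + ∑ k, A k * (A k)ᴴ = (2 : ℂ) • (1 : QMat) := by
    conv_lhs => rw [← hK]
    rw [← Finset.sum_add_distrib, Finset.sum_congr rfl fun k _ => key k,
      ← Finset.sum_smul, ← Matrix.trace_sum, hK]
    simp
  rw [two_smul] at hsum
  exact add_left_cancel hsum
end

section
/- For λ ∈ [0,1], let X = |x_λ⟩⟨x_λ| with x_λ = √λ|00⟩ + √(1−λ)|11⟩. Then the eigenvalues of the partial transpose X^Γ are λ, 1−λ, √(λ(1−λ)) and −√(λ(1−λ)); consequently, the two operator inequalities −(1/2)·1 ≤ X^Γ and X^Γ ≤ (1/2)·1 hold simultaneously if and only if λ = 1/2. -/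
open Matrix
open scoped Kronecker ComplexOrder

theorem ptransp_outer_xvec (l : ℝ) (hl : l ∈ Set.Icc (0 : ℝ) 1) :
    ptransp (outer (xvec l) (xvec l)) = Matrix.of fun p q =>
      if p.1 = q.2 ∧ p.2 = q.1 then
        if p = (0, 0) then (l : ℂ) else if p = (1, 1) then ((1 - l : ℝ) : ℂ)
        else (Real.sqrt (l * (1 - l)) : ℂ)
      else 0 := by
  have h0 : (Real.sqrt l : ℂ) * (Real.sqrt l : ℂ) = l := by
    rw [← Complex.ofReal_mul, Real.mul_self_sqrt hl.1]
  have h1 : (Real.sqrt (1 - l) : ℂ) * (Real.sqrt (1 - l) : ℂ) = ((1 - l : ℝ) : ℂ) := by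
    rw [← Complex.ofReal_mul, Real.mul_self_sqrt (sub_nonneg.2 hl.2)]
  have h2 : (Real.sqrt (l * (1 - l)) : ℂ) = (Real.sqrt l : ℂ) * (Real.sqrt (1 - l) : ℂ) := by
    rw [← Complex.ofReal_mul, Real.sqrt_mul hl.1]
  rw [h2, ← h1]
  ext ⟨a, b⟩ ⟨c, d⟩
  fin_cases a <;> fin_cases b <;> fin_cases c <;> fin_cases d <;>
    simp [ptransp, outer, xvec, Matrix.vecMulVec_apply, h0, mul_comm]

theorem det_ptransp_outer_xvec_sub (l : ℝ) (hl : l ∈ Set.Icc (0 : ℝ) 1) (x : ℂ) :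
    (ptransp (outer (xvec l) (xvec l)) - x • 1).det =
      ((l : ℂ) - x) * (((1 - l : ℝ) : ℂ) - x) *
        ((Real.sqrt (l * (1 - l)) : ℂ) - x) * (-(Real.sqrt (l * (1 - l)) : ℂ) - x) := by
  rw [ptransp_outer_xvec l hl]
  generalize (Real.sqrt (l * (1 - l)) : ℂ) = s
  generalize ((1 - l : ℝ) : ℂ) = m
  rw [← Matrix.det_submatrix_equiv_self (finProdFinEquiv (m := 2) (n := 2)).symm]
  have hM : ((Matrix.of fun p q : Fin 2 × Fin 2 =>
      if p.1 = q.2 ∧ p.2 = q.1 then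
        if p = (0, 0) then (l : ℂ) else if p = (1, 1) then m else s
      else 0) - x • 1).submatrix (finProdFinEquiv (m := 2) (n := 2)).symm
        (finProdFinEquiv (m := 2) (n := 2)).symm =
      (!![l - x, 0, 0, 0; 0, -x, s, 0; 0, s, -x, 0; 0, 0, 0, m - x] :
        Matrix (Fin 4) (Fin 4) ℂ) := by
    ext i j
    fin_cases i <;> fin_cases j <;>
      simp [finProdFinEquiv, Fin.divNat, Fin.modNat]
  refine (congrArg Matrix.det hM).trans ?_
  simp [Matrix.det_succ_row_zero, Fin.sum_univ_succ, Fin.succAbove]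
  ring

theorem ptransp_outer_xvec_half :
    ptransp (outer (xvec (1 / 2)) (xvec (1 / 2))) = (1 / 2 : ℂ) • swapM := by
  have hs : Real.sqrt (1 / 2 * (1 - 1 / 2)) = 1 / 2 := by
    rw [show (1 / 2 * (1 - 1 / 2) : ℝ) = (1 / 2) * (1 / 2) by norm_num]
    exact Real.sqrt_mul_self (by norm_num)
  rw [ptransp_outer_xvec _ (by norm_num), hs]
  ext p q
  simp only [Matrix.of_apply, swapM, Matrix.smul_apply, smul_eq_mul]
  split_ifs <;> norm_num

theorem swapM_isHermitian : swapM.IsHermitian := by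
  ext p q
  simp [swapM, Matrix.conjTranspose_apply, apply_ite, eq_comm, and_comm]

theorem swapM_mul_self : swapM * swapM = 1 := by
  ext ⟨a, b⟩ ⟨c, d⟩
  fin_cases a <;> fin_cases b <;> fin_cases c <;> fin_cases d <;>
    simp [swapM, Matrix.mul_apply, Fintype.sum_prod_type]

/-- Half of `1 + V` is an orthogonal projection when `V` is a Hermitian involution. -/
theorem posSemidef_half_one_add {n : Type*} [Fintype n] [DecidableEq n] {V : Matrix n n ℂ}
    (hV : V.IsHermitian) (hV2 : V * V = 1) : ((1 / 2 : ℂ) • (1 + V)).PosSemidef := by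
  have h := (Matrix.posSemidef_self_mul_conjTranspose (1 + V)).smul
    (a := (1 / 4 : ℝ)) (by norm_num)
  convert h using 1
  rw [Matrix.conjTranspose_add, Matrix.conjTranspose_one, hV.eq, add_mul, mul_add, mul_add, hV2]
  ext i j
  simp [Matrix.add_apply]
  ring

/-- the eigenvalues of the partial transpose of |x_λ⟩⟨x_λ| are
λ, 1−λ, ±√(λ(1−λ)); and −(1/2)·1 ≤ X^Γ ≤ (1/2)·1 holds iff λ = 1/2. -/
theorem stmt17 (l : ℝ) (hl : l ∈ Set.Icc (0 : ℝ) 1) :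
    (∀ x : ℂ, (ptransp (outer (xvec l) (xvec l)) - x • 1).det =
      ((l : ℂ) - x) * (((1 - l : ℝ) : ℂ) - x) *
        ((Real.sqrt (l * (1 - l)) : ℂ) - x) * (-(Real.sqrt (l * (1 - l)) : ℂ) - x)) ∧
    (((ptransp (outer (xvec l) (xvec l)) + (1/2 : ℂ) • 1).PosSemidef ∧
      ((1/2 : ℂ) • 1 - ptransp (outer (xvec l) (xvec l))).PosSemidef) ↔ l = 1/2) := by
  refine ⟨det_ptransp_outer_xvec_sub l hl, ?_, ?_⟩
  · rintro ⟨-, h⟩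
    have h0 := h.diag_nonneg (i := ((0, 0) : Fin 2 × Fin 2))
    have h1 := h.diag_nonneg (i := ((1, 1) : Fin 2 × Fin 2))
    rw [ptransp_outer_xvec l hl] at h0 h1
    have h0' := (Complex.le_def.1 h0).1
    have h1' := (Complex.le_def.1 h1).1
    simp at h0' h1'
    linarith
  · rintro rfl
    rw [ptransp_outer_xvec_half]
    constructor
    · simpa [smul_add, add_comm] using posSemidef_half_one_add swapM_isHermitian swapM_mul_self
    · simpa [smul_add, smul_neg, sub_eq_add_neg] using
        posSemidef_half_one_add swapM_isHermitian.neg (by simp [swapM_mul_self])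
end

section
/- Let Λ_p be the amplitude damping channel with parameter p ∈ [0,1] and let |φ(λ)⟩ = √λ|00⟩ + √(1−λ)|11⟩ for λ ∈ [0,1]. Then the negativity of the output state is N((id⊗Λ_p)(|φ(λ)⟩⟨φ(λ)|)) = √(p²(1−λ)² + 4λ(1−λ)(1−p)) − (1−λ)p. -/
open Matrix
open scoped Kronecker

/-- A real number `μ` that is an eigenvalue of a Hermitian matrix and a lower bound for all its
real eigenvalues is the smallest eigenvalue. -/
theorem lamMin_eq_of_forall_le {n : Type*} [Fintype n] [DecidableEq n] {M : Matrix n n ℂ}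
    (hM : M.IsHermitian) {μ : ℝ} {w : n → ℂ} (hw : w ≠ 0) (hμ : M *ᵥ w = (μ : ℂ) • w)
    (hle : ∀ (ν : ℝ) (v : n → ℂ), v ≠ 0 → M *ᵥ v = (ν : ℂ) • v → μ ≤ ν) :
    lamMin M = μ := by
  have hmem : μ ∈ Set.range hM.eigenvalues := by
    rw [← hM.spectrum_real_eq_range_eigenvalues]
    apply spectrum.of_algebraMap_mem ℂ
    rw [← Matrix.spectrum_toLin']
    refine (Module.End.hasEigenvalue_of_hasEigenvector (x := w) ?_).mem_spectrum
    refine ⟨Module.End.mem_eigenspace_iff.2 ?_, hw⟩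
    simpa using hμ
  have hlb : ∀ i, μ ≤ hM.eigenvalues i := fun i => by
    refine hle _ (hM.eigenvectorBasis i) (fun h => ?_) (hM.mulVec_eigenvectorBasis i)
    exact hM.eigenvectorBasis.orthonormal.ne_zero i (by ext j; exact congrFun h j)
  rw [lamMin, dif_pos hM]
  obtain ⟨i, hi⟩ := hmem
  have : Nonempty n := ⟨i⟩
  exact le_antisymm ((ciInf_le ⟨μ, by rintro _ ⟨j, rfl⟩; exact hlb j⟩ i).trans hi.le)
    (le_ciInf hlb)

/-- The two-qubit matrix with diagonal `a, 0, b, d` whose only off-diagonal entries, between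
`(0, 1)` and `(1, 0)`, are `c`. -/
def midBlock (a b c d : ℝ) : TMat := Matrix.of fun p q =>
  if p = q then (!![(a : ℂ), 0; (b : ℂ), (d : ℂ)]) p.1 p.2
  else if p.1 = q.2 ∧ p.2 = q.1 then (c : ℂ) else 0

theorem midBlock_isHermitian (a b c d : ℝ) : (midBlock a b c d).IsHermitian := by
  ext ⟨i, j⟩ ⟨k, m⟩
  fin_cases i <;> fin_cases j <;> fin_cases k <;> fin_cases m <;> simp [midBlock]

theorem midBlock_mulVec_eq_smul_iff (a b c d ν : ℝ) (v : TVec) :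
    midBlock a b c d *ᵥ v = (ν : ℂ) • v ↔
      a * v (0, 0) = ν * v (0, 0) ∧ c * v (1, 0) = ν * v (0, 1) ∧
        c * v (0, 1) + b * v (1, 0) = ν * v (1, 0) ∧ d * v (1, 1) = ν * v (1, 1) := by
  simp [funext_iff, Prod.forall, Fin.forall_fin_two, mulVec, dotProduct, Fintype.sum_prod_type,
    midBlock, and_assoc]

theorem lamMin_midBlock {a b c d : ℝ} (ha : 0 ≤ a) (hb : 0 ≤ b) (hd : 0 ≤ d) :
    lamMin (midBlock a b c d) = (b - √(b ^ 2 + 4 * c ^ 2)) / 2 := by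
  set s := √(b ^ 2 + 4 * c ^ 2) with hs
  have hs2 : s ^ 2 = b ^ 2 + 4 * c ^ 2 := Real.sq_sqrt (by positivity)
  have hbs : b ≤ s := Real.le_sqrt_of_sq_le (by nlinarith [sq_nonneg c])
  set μ := (b - s) / 2 with hμ
  have hroot : c ^ 2 + b * μ = μ ^ 2 := by rw [hμ]; linarith
  obtain ⟨x, y, hxy, h1, h2⟩ : ∃ x y : ℝ, (x ≠ 0 ∨ y ≠ 0) ∧ c * y = μ * x ∧
      c * x + b * y = μ * y := by
    by_cases h : c = 0 ∧ μ = 0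
    · exact ⟨1, 0, by simp, by simp [h.2], by simp [h.1]⟩
    · exact ⟨c, μ, by tauto, mul_comm _ _, by linarith⟩
  refine lamMin_eq_of_forall_le (midBlock_isHermitian a b c d)
    (w := fun p => (!![(0 : ℂ), (x : ℂ); (y : ℂ), 0]) p.1 p.2) (fun h => ?_) ?_ ?_
  · have hx := congrFun h (0, 1)
    have hy := congrFun h (1, 0)
    simp at hx hy
    tauto
  · rw [midBlock_mulVec_eq_smul_iff]
    simp
    exact ⟨by exact_mod_cast h1, by exact_mod_cast h2⟩
  · intro ν v hv hev
    by_contra! hlt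
    obtain ⟨e00, e01, e10, e11⟩ := (midBlock_mulVec_eq_smul_iff ..).1 hev
    have hneg : ν < 0 := by linarith
    have hdet : ((ν ^ 2 - b * ν - c ^ 2 : ℝ) : ℂ) ≠ 0 := by
      refine Complex.ofReal_ne_zero.2 (ne_of_gt ?_)
      have : 0 < (μ - ν) * (b - μ - ν) := mul_pos (by linarith) (by linarith)
      linarith
    have hna : ((a - ν : ℝ) : ℂ) ≠ 0 := Complex.ofReal_ne_zero.2 (by linarith)
    have hnd : ((d - ν : ℝ) : ℂ) ≠ 0 := Complex.ofReal_ne_zero.2 (by linarith)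
    refine hv (funext ?_)
    simp only [Prod.forall, Fin.forall_fin_two, Pi.zero_apply]
    refine ⟨⟨(mul_eq_zero_iff_left hna).1 ?_, (mul_eq_zero_iff_left hdet).1 ?_⟩,
      (mul_eq_zero_iff_left hdet).1 ?_, (mul_eq_zero_iff_left hnd).1 ?_⟩ <;> push_cast
    · linear_combination e00
    · linear_combination (b - ν : ℂ) * e01 - c * e10
    · linear_combination -(ν : ℂ) * e10 - c * e01
    · linear_combination e11

theorem ptransp_channelOut_adKraus {p l : ℝ} (hp : p ∈ Set.Icc (0 : ℝ) 1)
    (hl : l ∈ Set.Icc (0 : ℝ) 1) :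
    ptransp (channelOut (adKraus p) (outer (xvec l) (xvec l))) =
      midBlock l ((1 - l) * p) (√l * √(1 - l) * √(1 - p)) ((1 - l) * (1 - p)) := by
  have hsq {x : ℝ} (hx : 0 ≤ x) : (√x : ℂ) ^ 2 = x := by
    exact_mod_cast Real.sq_sqrt hx
  have h1 := hsq hl.1
  have h2 := hsq (sub_nonneg.2 hl.2)
  have h3 := hsq hp.1
  have h4 := hsq (sub_nonneg.2 hp.2)
  push_cast at h1 h2 h3 h4
  ext ⟨i, j⟩ ⟨k, m⟩
  fin_cases i <;> fin_cases j <;> fin_cases k <;> fin_cases m <;>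
    simp [ptransp, channelOut, outer, xvec, adKraus, midBlock, Matrix.mul_apply,
      Fintype.sum_prod_type, vecMulVec_apply, Matrix.one_apply]
  · linear_combination h1
  · ring
  · linear_combination (p : ℂ) * h2 + (√(1 - l) : ℂ) ^ 2 * h3
  · linear_combination (1 - p : ℂ) * h2 + (√(1 - l) : ℂ) ^ 2 * h4

/-- output negativity of the amplitude damping channel on the input
|φ(λ)⟩ = √λ|00⟩ + √(1−λ)|11⟩. -/
theorem stmt18 (p : ℝ) (hp : p ∈ Set.Icc (0 : ℝ) 1) (l : ℝ) (hl : l ∈ Set.Icc (0 : ℝ) 1) :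
    negativity (channelOut (adKraus p) (outer (xvec l) (xvec l))) =
      Real.sqrt (p ^ 2 * (1 - l) ^ 2 + 4 * l * (1 - l) * (1 - p)) - (1 - l) * p := by
  have hl' : 0 ≤ 1 - l := sub_nonneg.2 hl.2
  have hp' : 0 ≤ 1 - p := sub_nonneg.2 hp.2
  have hb : 0 ≤ (1 - l) * p := mul_nonneg hl' hp.1
  rw [negativity, ptransp_channelOut_adKraus hp hl,
    lamMin_midBlock hl.1 hb (mul_nonneg hl' hp')]
  have harg : ((1 - l) * p) ^ 2 + 4 * (√l * √(1 - l) * √(1 - p)) ^ 2 =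
      p ^ 2 * (1 - l) ^ 2 + 4 * l * (1 - l) * (1 - p) := by
    rw [mul_pow (√l * √(1 - l)), mul_pow √l, Real.sq_sqrt hl.1, Real.sq_sqrt hl',
      Real.sq_sqrt hp']
    ring
  have hle : (1 - l) * p ≤ √(((1 - l) * p) ^ 2 + 4 * (√l * √(1 - l) * √(1 - p)) ^ 2) :=
    Real.le_sqrt_of_sq_le (le_add_of_nonneg_right (by positivity))
  rw [max_eq_right (by linarith), harg]
  ring
end

section
/- Let Λ_p be the amplitude damping channel with 0 < p < 1. Then the output negativity of the maximally entangled input is strictly smaller than that of the input |φ(1/(2−p))⟩: N((id⊗Λ_p)(|Φ⁺⟩⟨Φ⁺|)) < N((id⊗Λ_p)(|φ(1/(2−p))⟩⟨φ(1/(2−p))|)); equivalently, √(p²/4 + 1 − p) − p/2 < ((1−p)/(2−p))·(√(p²+4) − p). Hence for this nonunital channel the maximal output negativity over pure inputs strictly exceeds the negativity of the Choi state. -/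
open Matrix
open scoped Kronecker

/-- The vector `a|00⟩ + b|11⟩`. -/
def schmidtVec (a b : ℝ) : TVec := fun q =>
  if q = (0, 0) then (a : ℂ) else if q = (1, 1) then (b : ℂ) else 0

/-- The matrix with diagonal `x, 0, d, y` in the basis `|00⟩, |01⟩, |10⟩, |11⟩` and entries `c`
coupling `|01⟩` and `|10⟩`. -/
def coupledMat (x d y c : ℝ) : TMat := Matrix.of fun q r =>
  if q = (0, 0) ∧ r = (0, 0) then (x : ℂ)
  else if q = (1, 0) ∧ r = (1, 0) then (d : ℂ)
  else if q = (1, 1) ∧ r = (1, 1) then (y : ℂ)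
  else if q = (0, 1) ∧ r = (1, 0) then (c : ℂ)
  else if q = (1, 0) ∧ r = (0, 1) then (c : ℂ)
  else 0

theorem phiPlus_eq_schmidtVec : phiPlus = schmidtVec (√2)⁻¹ (√2)⁻¹ := by
  funext ⟨i, j⟩
  fin_cases i <;> fin_cases j <;> simp [phiPlus, schmidtVec]

theorem ptransp_channelOut_schmidtVec {p : ℝ} (hp0 : 0 ≤ p) (hp1 : p ≤ 1) (a b : ℝ) :
    ptransp (channelOut (adKraus p) (outer (schmidtVec a b) (schmidtVec a b))) =
      coupledMat (a ^ 2) (b ^ 2 * p) (b ^ 2 * (1 - p)) (a * b * √(1 - p)) := by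
  have h1 : ((√p : ℝ) : ℂ) * ((√p : ℝ) : ℂ) = p := by
    rw [← Complex.ofReal_mul, Real.mul_self_sqrt hp0]
  have h2 : ((√(1 - p) : ℝ) : ℂ) * ((√(1 - p) : ℝ) : ℂ) = 1 - p := by
    rw [← Complex.ofReal_mul, Real.mul_self_sqrt (sub_nonneg.2 hp1)]
    push_cast
    rfl
  ext ⟨i, j⟩ ⟨k, l⟩
  fin_cases i <;> fin_cases j <;> fin_cases k <;> fin_cases l <;>
    simp [ptransp, channelOut, adKraus, outer, schmidtVec, coupledMat, Matrix.mul_apply,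
      Fintype.sum_prod_type, Matrix.vecMulVec_apply, Matrix.kroneckerMap_apply,
      Matrix.one_apply] <;>
    first
    | ring1
    | linear_combination (b : ℂ) ^ 2 * h1
    | linear_combination (b : ℂ) ^ 2 * h2

theorem coupledMat_isHermitian (x d y c : ℝ) : (coupledMat x d y c).IsHermitian := by
  ext ⟨i, j⟩ ⟨k, l⟩
  fin_cases i <;> fin_cases j <;> fin_cases k <;> fin_cases l <;> simp [coupledMat]

theorem coupledMat_mulVec (x d y c : ℝ) (v : TVec) :
    (coupledMat x d y c) *ᵥ v = fun q =>
      if q = (0, 0) then x * v (0, 0)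
      else if q = (0, 1) then c * v (1, 0)
      else if q = (1, 0) then c * v (0, 1) + d * v (1, 0)
      else y * v (1, 1) := by
  funext ⟨i, j⟩
  fin_cases i <;> fin_cases j <;>
    simp [coupledMat, Matrix.mulVec, dotProduct, Fintype.sum_prod_type]

theorem lamMin_eq {n : Type*} [Fintype n] [DecidableEq n] {M : Matrix n n ℂ} (hM : M.IsHermitian)
    {r : ℝ} {w : n → ℂ} (hw : w ≠ 0) (hMw : M *ᵥ w = (r : ℂ) • w)
    (hr : ∀ (e : ℝ) (v : n → ℂ), v ≠ 0 → M *ᵥ v = (e : ℂ) • v → r ≤ e) : lamMin M = r := by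
  have hmem : r ∈ Set.range hM.eigenvalues := by
    rw [← hM.spectrum_real_eq_range_eigenvalues, spectrum.mem_iff, Matrix.isUnit_iff_isUnit_det,
      isUnit_iff_ne_zero, not_not, ← Matrix.exists_mulVec_eq_zero_iff]
    refine ⟨w, hw, ?_⟩
    rw [Matrix.sub_mulVec, hMw, Algebra.algebraMap_eq_smul_one, Matrix.smul_mulVec,
      Matrix.one_mulVec]
    ext i
    simp
  obtain ⟨i, hi⟩ := hmem
  rw [lamMin, dif_pos hM]
  refine le_antisymm (hi ▸ ciInf_le (Set.finite_range _).bddBelow i) ?_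
  have : Nonempty n := ⟨i⟩
  refine le_ciInf fun j => hr _ _ ?_ (hM.mulVec_eigenvectorBasis j)
  intro h
  have := hM.eigenvectorBasis.orthonormal.ne_zero j
  exact this (by ext k; exact congrFun h k)

theorem lamMin_coupledMat {x d y c : ℝ} (hx : 0 ≤ x) (hd : 0 ≤ d) (hy : 0 ≤ y) (hc : 0 < c) :
    lamMin (coupledMat x d y c) = (d - √(d ^ 2 + 4 * c ^ 2)) / 2 := by
  set s := √(d ^ 2 + 4 * c ^ 2)
  have hs2 : s ^ 2 = d ^ 2 + 4 * c ^ 2 := Real.sq_sqrt (by positivity)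
  have hsd : d ≤ s := Real.le_sqrt_of_sq_le (by nlinarith [sq_nonneg c])
  have hs2' : (s : ℂ) ^ 2 = d ^ 2 + 4 * c ^ 2 := by exact_mod_cast hs2
  refine lamMin_eq (coupledMat_isHermitian x d y c)
    (w := fun q => if q = (0, 1) then (c : ℂ) else
      if q = (1, 0) then (((d - s) / 2 : ℝ) : ℂ) else 0) ?_ ?_ ?_
  · intro h
    have := congrFun h (0, 1)
    simp [hc.ne'] at this
  · rw [coupledMat_mulVec]
    funext ⟨i, j⟩
    fin_cases i <;> fin_cases j <;> simp <;> first | ring1 | linear_combination (-1 / 4 : ℂ) * hs2'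
  · intro e v hv h
    rw [coupledMat_mulVec] at h
    have h00 := congrFun h (0, 0)
    have h01 := congrFun h (0, 1)
    have h10 := congrFun h (1, 0)
    have h11 := congrFun h (1, 1)
    simp only [Pi.smul_apply, smul_eq_mul, Prod.mk.injEq, and_self, if_true, zero_ne_one,
      one_ne_zero, and_true, and_false, if_false] at h00 h01 h10 h11
    by_contra! hlt
    have hex : (x : ℂ) - e ≠ 0 := by
      rw [sub_ne_zero]
      exact_mod_cast (show e < x by linarith).ne'
    have hey : (y : ℂ) - e ≠ 0 := by
      rw [sub_ne_zero]
      exact_mod_cast (show e < y by linarith).ne'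
    have hroot : (c : ℂ) ^ 2 + e * d - e ^ 2 ≠ 0 := by
      have hne : c ^ 2 + e * d - e ^ 2 ≠ 0 := by
        nlinarith [Real.sqrt_nonneg (d ^ 2 + 4 * c ^ 2)]
      exact_mod_cast hne
    have hcc : (c : ℂ) ≠ 0 := by exact_mod_cast hc.ne'
    have v00 : v (0, 0) = 0 :=
      (mul_eq_zero.1 (by linear_combination h00 : ((x : ℂ) - e) * v (0, 0) = 0)).resolve_left hex
    have v11 : v (1, 1) = 0 :=
      (mul_eq_zero.1 (by linear_combination h11 : ((y : ℂ) - e) * v (1, 1) = 0)).resolve_left hey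
    have v10 : v (1, 0) = 0 :=
      (mul_eq_zero.1 (by linear_combination c * h01 + e * h10 :
        ((c : ℂ) ^ 2 + e * d - e ^ 2) * v (1, 0) = 0)).resolve_left hroot
    have v01 : v (0, 1) = 0 := by
      rw [v10, mul_zero, mul_zero, add_zero] at h10
      exact (mul_eq_zero.1 h10).resolve_left hcc
    refine hv (funext fun ⟨i, j⟩ => ?_)
    fin_cases i <;> fin_cases j <;> assumption

theorem negativity_channelOut_schmidtVec {p a b : ℝ} (hp0 : 0 ≤ p) (hp1 : p < 1) (ha : 0 < a)
    (hb : 0 < b) :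
    negativity (channelOut (adKraus p) (outer (schmidtVec a b) (schmidtVec a b))) =
      √((b ^ 2 * p) ^ 2 + 4 * (a ^ 2 * b ^ 2 * (1 - p))) - b ^ 2 * p := by
  have h1p : 0 < 1 - p := sub_pos.2 hp1
  rw [negativity, ptransp_channelOut_schmidtVec hp0 hp1.le,
    lamMin_coupledMat (by positivity) (by positivity) (by positivity) (by positivity),
    mul_pow (a * b), mul_pow a, Real.sq_sqrt h1p.le, max_eq_right]
  · ring
  · have : b ^ 2 * p ≤ √((b ^ 2 * p) ^ 2 + 4 * (a ^ 2 * b ^ 2 * (1 - p))) :=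
      Real.le_sqrt_of_sq_le (le_add_of_nonneg_right (by positivity))
    linarith

theorem sqrt_sub_lt_div_mul_sqrt_sub {p : ℝ} (hp0 : 0 < p) (hp1 : p < 1) :
    √(p ^ 2 / 4 + 1 - p) - p / 2 < ((1 - p) / (2 - p)) * (√(p ^ 2 + 4) - p) := by
  have h2p : 0 < 2 - p := by linarith
  have hsqrt : √(p ^ 2 / 4 + 1 - p) = (2 - p) / 2 := by
    rw [show p ^ 2 / 4 + 1 - p = ((2 - p) / 2) ^ 2 by ring, Real.sqrt_sq (by positivity)]
  have hlt : 2 < √(p ^ 2 + 4) := Real.lt_sqrt_of_sq_lt (by nlinarith)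
  rw [hsqrt, div_mul_eq_mul_div, lt_div_iff₀ h2p]
  nlinarith

/-- for the amplitude damping channel with 0 < p < 1, the output negativity
of the maximally entangled input is strictly smaller than that of |φ(1/(2−p))⟩. -/
theorem stmt19 (p : ℝ) (hp : p ∈ Set.Ioo (0 : ℝ) 1) :
    negativity (channelOut (adKraus p) (outer phiPlus phiPlus)) <
      negativity (channelOut (adKraus p)
        (outer (xvec (1 / (2 - p))) (xvec (1 / (2 - p))))) ∧
    Real.sqrt (p ^ 2 / 4 + 1 - p) - p / 2 <
      ((1 - p) / (2 - p)) * (Real.sqrt (p ^ 2 + 4) - p) := by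
  obtain ⟨hp0, hp1⟩ := hp
  have hlt := sqrt_sub_lt_div_mul_sqrt_sub hp0 hp1
  refine ⟨?_, hlt⟩
  have h1p : 0 < 1 - p := sub_pos.2 hp1
  have h2p : 0 < 2 - p := by linarith
  have hμ : 1 - 1 / (2 - p) = (1 - p) / (2 - p) := by
    field_simp
    ring
  have hphi : xvec (1 / (2 - p)) = schmidtVec √(1 / (2 - p)) √((1 - p) / (2 - p)) := by
    rw [← hμ]
    rfl
  have hd : 0 < (1 - p) / (2 - p) := by positivity
  rw [phiPlus_eq_schmidtVec, hphi,
    negativity_channelOut_schmidtVec hp0.le hp1 (by positivity) (by positivity),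
    negativity_channelOut_schmidtVec hp0.le hp1 (by positivity) (Real.sqrt_pos.2 hd),
    inv_pow, Real.sq_sqrt zero_le_two, Real.sq_sqrt hd.le,
    Real.sq_sqrt (one_div_pos.2 h2p).le]
  convert hlt using 1
  · congr 1
    · congr 1
      ring
    · ring
  · have hmul : (1 - p) / (2 - p) * √(p ^ 2 + 4) = √(((1 - p) / (2 - p)) ^ 2 * (p ^ 2 + 4)) := by
      rw [Real.sqrt_mul (sq_nonneg _), Real.sqrt_sq hd.le]
    rw [mul_sub ((1 - p) / (2 - p)) √(p ^ 2 + 4), hmul]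
    congr 2
    field_simp
end
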